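/- Let (W,S) be a Coxeter system of finite rank and let u ≤ v in Bruhat order with the interval [u,v] = { x ∈ W : u ≤ x ≤ v } finite. Set I := { s ∈ S : ℓ(su) > ℓ(u) and ℓ(sv) < ℓ(v) } and J := { s ∈ S : ℓ(us) > ℓ(u) and ℓ(vs) < ℓ(v) }. Then [u,v] is a parabolic double coset (i.e. equals W_{I'} x W_{J'} for some I', J' ⊆ S and x ∈ W) if and only if u is the minimal-length element of the double coset W_I v W_J; and in that case [u,v] = W_I v W_J. -/

import Mathlib

open CoxeterSystem

variable {B : Type*} {W : Type*} [Group W]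

/-- The standard parabolic subgroup `W_I` of a Coxeter system, generated by the
simple reflections indexed by `I`. -/
def CoxeterSystem.parabolic {M : CoxeterMatrix B} (cs : CoxeterSystem M W) (I : Set B) :
    Subgroup W :=
  Subgroup.closure (cs.simple '' I)

/-- The parabolic double coset `W_I w W_J`. -/
def CoxeterSystem.doubleCoset {M : CoxeterMatrix B} (cs : CoxeterSystem M W) (I : Set B)
    (w : W) (J : Set B) : Set W :=
  {x | ∃ u ∈ cs.parabolic I, ∃ v ∈ cs.parabolic J, x = u * w * v}

/-- The Bruhat order on a Coxeter group: the partial order generated by the relations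
`a < a * t` for reflections `t` with `ℓ(a) < ℓ(a * t)`. -/
def CoxeterSystem.bruhatLE {M : CoxeterMatrix B} (cs : CoxeterSystem M W) (x y : W) : Prop :=
  Relation.ReflTransGen
    (fun a b => (∃ t : W, cs.IsReflection t ∧ b = a * t) ∧ cs.length a < cs.length b) x y

namespace CoxeterSystem

open Relation

section StrongExchange

variable {M : CoxeterMatrix B} (cs : CoxeterSystem M W)

open Classical in
/-- The involution of `W × ZMod 2` attached to a simple reflection `s`: it conjugates the first
coordinate by `s` and flips the second one exactly when the first coordinate is `s`. -/
noncomputable def reflectionPerm (i : B) : Equiv.Perm (W × ZMod 2) :=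
  Function.Involutive.toPerm
    (fun p => (cs.simple i * p.1 * cs.simple i, p.2 + if p.1 = cs.simple i then 1 else 0)) <| by
    rintro ⟨t, e⟩
    have h : cs.simple i * t * cs.simple i = cs.simple i ↔ t = cs.simple i := by
      constructor
      · intro h
        have := congrArg (fun x => cs.simple i * x * cs.simple i) h
        simpa [mul_assoc] using this
      · rintro rfl
        simp
    simp only [h, Prod.mk.injEq]
    refine ⟨by simp [mul_assoc], ?_⟩
    rw [add_assoc, CharTwo.add_self_eq_zero, add_zero]

open Classical in
theorem reflectionPerm_apply (i : B) (t : W) (e : ZMod 2) :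
    cs.reflectionPerm i (t, e) =
      (cs.simple i * t * cs.simple i, e + if t = cs.simple i then 1 else 0) := rfl

theorem simple_mul_pow_eq (i j : B) (k : ℕ) :
    cs.simple j * (cs.simple i * cs.simple j) ^ k =
      ((cs.simple i * cs.simple j) ^ k)⁻¹ * cs.simple j := by
  induction k with
  | zero => simp
  | succ k ih =>
    rw [pow_succ, ← mul_assoc, ih, ← pow_succ, pow_succ', mul_inv_rev]
    simp [mul_assoc]

open Classical in
theorem reflectionPerm_mul_pow_apply (i j : B) (n : ℕ) (t : W) (e : ZMod 2) :
    ((cs.reflectionPerm i * cs.reflectionPerm j) ^ n) (t, e) =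
      ((cs.simple i * cs.simple j) ^ n * t * ((cs.simple i * cs.simple j) ^ n)⁻¹,
        e + ∑ l ∈ Finset.range (2 * n),
          if t = cs.simple j * (cs.simple i * cs.simple j) ^ l then 1 else 0) := by
  induction n with
  | zero => simp
  | succ n ih =>
    rw [pow_succ', Equiv.Perm.mul_apply, ih, Equiv.Perm.mul_apply, reflectionPerm_apply,
      reflectionPerm_apply]
    set r := cs.simple i * cs.simple j with hr
    have h₁ : r ^ n * t * (r ^ n)⁻¹ = cs.simple j ↔ t = cs.simple j * r ^ (2 * n) := by
      rw [two_mul, pow_add, ← mul_assoc, hr, simple_mul_pow_eq, ← hr, mul_inv_eq_iff_eq_mul,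
        mul_assoc, eq_inv_mul_iff_mul_eq]
    have h₂ : cs.simple j * (r ^ n * t * (r ^ n)⁻¹) * cs.simple j = cs.simple i ↔
        t = cs.simple j * r ^ (2 * n + 1) := by
      have : cs.simple j * r ^ (2 * n + 1) = (r ^ n)⁻¹ * (cs.simple j * r) * r ^ n := by
        rw [show 2 * n + 1 = n + (1 + n) by ring, pow_add, ← mul_assoc, hr, simple_mul_pow_eq,
          ← hr, pow_add, pow_one]
        simp only [mul_assoc]
      rw [this]
      constructor
      · intro h
        have hj : cs.simple j * r = cs.simple j * cs.simple i * cs.simple j := by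
          rw [hr, mul_assoc]
        rw [hj, ← h]
        simp [mul_assoc]
      · intro h
        rw [h, hr]
        simp [mul_assoc]
    simp only [h₁, h₂, show 2 * (n + 1) = 2 * n + 1 + 1 by ring, Finset.sum_range_succ]
    refine Prod.ext ?_ ?_
    · simp [hr, pow_succ', mul_assoc]
    · simp only [add_assoc]

theorem isLiftable_reflectionPerm : M.IsLiftable cs.reflectionPerm := by
  classical
  intro i j
  ext1 ⟨t, e⟩
  rw [reflectionPerm_mul_pow_apply, cs.simple_mul_simple_pow, two_mul, Finset.sum_range_add]
  simp only [pow_add, cs.simple_mul_simple_pow, one_mul, CharTwo.add_self_eq_zero]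
  simp

/-- The action of `W` on `W × ZMod 2` extending `reflectionPerm`. -/
noncomputable def reflectionRep : W →* Equiv.Perm (W × ZMod 2) :=
  cs.lift ⟨cs.reflectionPerm, cs.isLiftable_reflectionPerm⟩

theorem reflectionRep_simple (i : B) : cs.reflectionRep (cs.simple i) = cs.reflectionPerm i :=
  cs.lift_apply_simple cs.isLiftable_reflectionPerm i

/-- The inversion cocycle: for a reflection `t` it is `1` if `t` is a right inversion of `w` and
`0` otherwise. -/
noncomputable def inversionParity (w t : W) : ZMod 2 := (cs.reflectionRep w (t, 0)).2

open Classical in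
theorem reflectionRep_wordProd (ω : List B) (t : W) (e : ZMod 2) :
    cs.reflectionRep (cs.wordProd ω) (t, e) =
      (cs.wordProd ω * t * (cs.wordProd ω)⁻¹, e + ((cs.rightInvSeq ω).count t : ZMod 2)) := by
  induction ω with
  | nil => simp
  | cons i ω ih =>
    rw [wordProd_cons, map_mul, Equiv.Perm.mul_apply, ih, reflectionRep_simple,
      reflectionPerm_apply]
    have h : cs.wordProd ω * t * (cs.wordProd ω)⁻¹ = cs.simple i ↔
        (cs.wordProd ω)⁻¹ * cs.simple i * cs.wordProd ω = t := by
      constructor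
      · intro h
        rw [← h]
        group
      · intro h
        rw [← h]
        group
    simp only [rightInvSeq, List.count_cons, h, beq_iff_eq]
    refine Prod.ext ?_ ?_
    · simp [mul_assoc]
    · simp only [add_assoc]
      push_cast
      rfl

theorem reflectionRep_apply (w t : W) (e : ZMod 2) :
    cs.reflectionRep w (t, e) = (w * t * w⁻¹, e + cs.inversionParity w t) := by
  obtain ⟨ω, rfl⟩ := cs.wordProd_surjective w
  simp [inversionParity, reflectionRep_wordProd]

theorem inversionParity_mul (w w' t : W) :
    cs.inversionParity (w * w') t =
      cs.inversionParity w' t + cs.inversionParity w (w' * t * w'⁻¹) := by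
  rw [inversionParity, map_mul, Equiv.Perm.mul_apply, reflectionRep_apply, reflectionRep_apply]
  simp

theorem inversionParity_one (t : W) : cs.inversionParity 1 t = 0 := by
  simp [inversionParity]

open Classical in
theorem inversionParity_simple (i : B) (t : W) :
    cs.inversionParity (cs.simple i) t = if t = cs.simple i then 1 else 0 := by
  simp [inversionParity, reflectionRep_simple, reflectionPerm_apply]

theorem IsReflection.inversionParity_self {cs : CoxeterSystem M W} {t : W}
    (ht : cs.IsReflection t) : cs.inversionParity t t = 1 := by
  obtain ⟨g, i, rfl⟩ := ht
  have h := cs.inversionParity_mul g g⁻¹ (g * cs.simple i * g⁻¹)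
  have hc : g⁻¹ * (g * cs.simple i * g⁻¹) * g⁻¹⁻¹ = cs.simple i := by group
  rw [hc, mul_inv_cancel, inversionParity_one] at h
  rw [inversionParity_mul, hc, inversionParity_mul]
  simp only [inversionParity_simple, if_true, inv_simple, simple_mul_simple_self, one_mul]
  rw [add_left_comm, ← h, add_zero]

theorem isRightInversion_of_inversionParity {w t : W} (h : cs.inversionParity w t = 1) :
    cs.IsRightInversion w t := by
  classical
  obtain ⟨ω, hω, rfl⟩ := cs.exists_isReduced w
  refine cs.isRightInversion_of_mem_rightInvSeq hω ?_
  by_contra hn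
  simp [inversionParity, reflectionRep_wordProd, List.count_eq_zero_of_not_mem hn] at h

theorem IsReflection.inversionParity_eq_one_iff {cs : CoxeterSystem M W} {t : W}
    (ht : cs.IsReflection t) (w : W) :
    cs.inversionParity w t = 1 ↔ cs.length (w * t) < cs.length w := by
  refine ⟨fun h => (cs.isRightInversion_of_inversionParity h).2, fun h => ?_⟩
  by_contra hn
  have h₀ : cs.inversionParity w t = 0 := by
    generalize cs.inversionParity w t = e at hn
    revert e
    decide
  have h₁ : cs.inversionParity (w * t) t = 1 := by
    rw [inversionParity_mul, ht.inversionParity_self, mul_inv_cancel_right, h₀, add_zero]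
  have h₂ := (cs.isRightInversion_of_inversionParity h₁).2
  rw [mul_assoc, ht.mul_self, mul_one] at h₂
  omega

/-- Right multiplication by a simple reflection `s` transports right inversions other than `s`. -/
theorem IsReflection.length_mul_simple_lt_iff {cs : CoxeterSystem M W} {t : W}
    (ht : cs.IsReflection t) {i : B} (hi : t ≠ cs.simple i) (w : W) :
    cs.length (w * t * cs.simple i) < cs.length (w * cs.simple i) ↔
      cs.length (w * t) < cs.length w := by
  have ht' : cs.IsReflection (cs.simple i * t * cs.simple i) := by
    simpa using ht.conj (cs.simple i)
  have hne : cs.simple i * t * cs.simple i ≠ cs.simple i := by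
    intro h
    have := congrArg (fun x => cs.simple i * x * cs.simple i) h
    exact hi (by simpa [mul_assoc] using this)
  have hc : cs.simple i * (cs.simple i * t * cs.simple i) * (cs.simple i)⁻¹ = t := by
    simp [mul_assoc]
  have hm : w * cs.simple i * (cs.simple i * t * cs.simple i) = w * t * cs.simple i := by
    simp [mul_assoc]
  rw [← ht.inversionParity_eq_one_iff, ← hm, ← ht'.inversionParity_eq_one_iff,
    inversionParity_mul, inversionParity_simple, if_neg hne, zero_add, hc]

end StrongExchange

section Bruhat

variable {M : CoxeterMatrix B} {cs : CoxeterSystem M W}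

theorem bruhatLE.refl (x : W) : cs.bruhatLE x x := ReflTransGen.refl

theorem bruhatLE.trans {x y z : W} (hxy : cs.bruhatLE x y) (hyz : cs.bruhatLE y z) :
    cs.bruhatLE x z := ReflTransGen.trans hxy hyz

theorem bruhatLE.eq_or_length_lt {x y : W} (h : cs.bruhatLE x y) :
    x = y ∨ cs.length x < cs.length y := by
  induction h with
  | refl => exact Or.inl rfl
  | tail _ h ih =>
    rcases ih with rfl | ih
    · exact Or.inr h.2
    · exact Or.inr (ih.trans h.2)

theorem bruhatLE.antisymm {x y : W} (hxy : cs.bruhatLE x y) (hyx : cs.bruhatLE y x) : x = y := by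
  rcases hxy.eq_or_length_lt with h | h
  · exact h
  · rcases hyx.eq_or_length_lt with h' | h'
    · exact h'.symm
    · omega

theorem bruhatLE.inv {x y : W} (h : cs.bruhatLE x y) : cs.bruhatLE x⁻¹ y⁻¹ := by
  induction h with
  | refl => exact bruhatLE.refl _
  | @tail a _ _ h ih =>
    obtain ⟨⟨t, ht, rfl⟩, hl⟩ := h
    refine ih.tail ⟨⟨a * t * a⁻¹, ht.conj a, ?_⟩, by simpa only [length_inv] using hl⟩
    simp [mul_assoc, ht.inv]

theorem bruhatLE_mul_simple {x : W} {i : B} (h : cs.length x < cs.length (x * cs.simple i)) :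
    cs.bruhatLE x (x * cs.simple i) :=
  ReflTransGen.single ⟨⟨_, cs.isReflection_simple i, rfl⟩, h⟩

theorem bruhatLE_simple_mul {x : W} {i : B} (h : cs.length x < cs.length (cs.simple i * x)) :
    cs.bruhatLE x (cs.simple i * x) := by
  have h' : cs.length x⁻¹ < cs.length (x⁻¹ * cs.simple i) := by
    rwa [← cs.length_inv (x⁻¹ * _), length_inv, mul_inv_rev, inv_simple, inv_inv]
  simpa using (bruhatLE_mul_simple h').inv

theorem mul_simple_bruhatLE {x : W} {i : B} (h : cs.length (x * cs.simple i) < cs.length x) :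
    cs.bruhatLE (x * cs.simple i) x := by
  simpa using bruhatLE_mul_simple (cs := cs) (x := x * cs.simple i) (i := i) (by simpa using h)

theorem simple_mul_bruhatLE {x : W} {i : B} (h : cs.length (cs.simple i * x) < cs.length x) :
    cs.bruhatLE (cs.simple i * x) x := by
  simpa using bruhatLE_simple_mul (cs := cs) (x := cs.simple i * x) (i := i) (by simpa using h)

/-- Right multiplication by a simple reflection `s` maps a Bruhat relation `a < a * t` with `t ≠ s`
to a Bruhat relation. -/
theorem mul_simple_eq_or_bruhatLE {a t : W} (ht : cs.IsReflection t)
    (hl : cs.length a < cs.length (a * t)) (i : B) :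
    a * cs.simple i = a * t ∨ cs.bruhatLE (a * cs.simple i) (a * t * cs.simple i) := by
  by_cases hi : t = cs.simple i
  · exact Or.inl (by rw [hi])
  · refine Or.inr (ReflTransGen.single
      ⟨⟨cs.simple i * t * cs.simple i, by simpa using ht.conj (cs.simple i), ?_⟩, ?_⟩)
    · simp [mul_assoc]
    · have := (ht.length_mul_simple_lt_iff hi (a * t)).not
      rw [mul_assoc a t t, ht.mul_self, mul_one] at this
      simpa [hl] using this

theorem bruhatLE.mul_simple_le {a b : W} (h : cs.bruhatLE a b) (i : B) :
    cs.bruhatLE (a * cs.simple i) b ∨ cs.bruhatLE (a * cs.simple i) (b * cs.simple i) := by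
  induction h using ReflTransGen.head_induction_on with
  | refl => exact Or.inr (bruhatLE.refl _)
  | head h hcb ih =>
    obtain ⟨⟨t, ht, rfl⟩, hl⟩ := h
    rcases mul_simple_eq_or_bruhatLE ht hl i with h | h
    · exact Or.inl (h ▸ hcb)
    · exact ih.imp h.trans h.trans

theorem bruhatLE.le_mul_simple {a b : W} (h : cs.bruhatLE a b) (i : B) :
    cs.bruhatLE a (b * cs.simple i) ∨ cs.bruhatLE (a * cs.simple i) (b * cs.simple i) := by
  induction h with
  | refl => exact Or.inr (bruhatLE.refl _)
  | tail hac h ih =>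
    obtain ⟨⟨t, ht, rfl⟩, hl⟩ := h
    rcases mul_simple_eq_or_bruhatLE ht hl i with h | h
    · refine Or.inl ?_
      rw [← h, simple_mul_simple_cancel_right]
      exact hac
    · exact ih.imp (fun h' => h'.trans h) (fun h' => h'.trans h)

theorem bruhatLE.simple_mul_le {a b : W} (h : cs.bruhatLE a b) (i : B) :
    cs.bruhatLE (cs.simple i * a) b ∨ cs.bruhatLE (cs.simple i * a) (cs.simple i * b) :=
  (h.inv.mul_simple_le i).imp (fun h => by simpa using h.inv) (fun h => by simpa using h.inv)

theorem bruhatLE.le_simple_mul {a b : W} (h : cs.bruhatLE a b) (i : B) :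
    cs.bruhatLE a (cs.simple i * b) ∨ cs.bruhatLE (cs.simple i * a) (cs.simple i * b) :=
  (h.inv.le_mul_simple i).imp (fun h => by simpa using h.inv) (fun h => by simpa using h.inv)

end Bruhat

section DoubleCoset

variable {M : CoxeterMatrix B} {cs : CoxeterSystem M W} {I J : Set B}

theorem self_mem_doubleCoset (w : W) : w ∈ cs.doubleCoset I w J :=
  ⟨1, one_mem _, 1, one_mem _, by simp⟩

theorem simple_mul_mem_doubleCoset {w x : W} (h : x ∈ cs.doubleCoset I w J) {i : B}
    (hi : i ∈ I) : cs.simple i * x ∈ cs.doubleCoset I w J := by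
  obtain ⟨a, ha, b, hb, rfl⟩ := h
  exact ⟨cs.simple i * a, mul_mem (Subgroup.subset_closure ⟨i, hi, rfl⟩) ha, b, hb,
    by simp only [mul_assoc]⟩

theorem mul_simple_mem_doubleCoset {w x : W} (h : x ∈ cs.doubleCoset I w J) {i : B}
    (hi : i ∈ J) : x * cs.simple i ∈ cs.doubleCoset I w J := by
  obtain ⟨a, ha, b, hb, rfl⟩ := h
  exact ⟨a, ha, b * cs.simple i, mul_mem hb (Subgroup.subset_closure ⟨i, hi, rfl⟩),
    by simp only [mul_assoc]⟩

theorem mem_doubleCoset_symm {x y : W} (h : x ∈ cs.doubleCoset I y J) :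
    y ∈ cs.doubleCoset I x J := by
  obtain ⟨a, ha, b, hb, rfl⟩ := h
  exact ⟨a⁻¹, inv_mem ha, b⁻¹, inv_mem hb, by simp [mul_assoc]⟩

theorem mem_doubleCoset_trans {x y z : W} (h : x ∈ cs.doubleCoset I y J)
    (h' : y ∈ cs.doubleCoset I z J) : x ∈ cs.doubleCoset I z J := by
  obtain ⟨a, ha, b, hb, rfl⟩ := h
  obtain ⟨c, hc, d, hd, rfl⟩ := h'
  exact ⟨a * c, mul_mem ha hc, d * b, mul_mem hd hb, by simp only [mul_assoc]⟩

theorem doubleCoset_mono {I' J' : Set B} (hI : I' ⊆ I) (hJ : J' ⊆ J) (w : W) :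
    cs.doubleCoset I' w J' ⊆ cs.doubleCoset I w J := by
  rintro _ ⟨a, ha, b, hb, rfl⟩
  exact ⟨a, Subgroup.closure_mono (Set.image_mono hI) ha, b,
    Subgroup.closure_mono (Set.image_mono hJ) hb, rfl⟩

/-- A property stable under left multiplication by `s ∈ I` and right multiplication by `s ∈ J`
propagates along double cosets. -/
theorem doubleCoset_induction {p : W → Prop} (hI : ∀ i ∈ I, ∀ x, p x → p (cs.simple i * x))
    (hJ : ∀ i ∈ J, ∀ x, p x → p (x * cs.simple i)) {w x : W} (hw : p w)
    (hx : x ∈ cs.doubleCoset I w J) : p x := by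
  obtain ⟨a, ha, b, hb, rfl⟩ := hx
  have hL : ∀ x, p x ↔ p (a * x) := by
    induction ha using Subgroup.closure_induction with
    | mem _ h =>
      obtain ⟨i, hi, rfl⟩ := h
      exact fun x => ⟨hI i hi x, fun h => by simpa using hI i hi _ h⟩
    | one => simp
    | mul a b _ _ iha ihb => exact fun x => by rw [ihb, iha, mul_assoc]
    | inv a _ ih => exact fun x => by rw [ih (a⁻¹ * x), mul_inv_cancel_left]
  have hR : ∀ x, p x ↔ p (x * b) := by
    induction hb using Subgroup.closure_induction with
    | mem _ h =>
      obtain ⟨i, hi, rfl⟩ := h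
      exact fun x => ⟨hJ i hi x, fun h => by simpa using hJ i hi _ h⟩
    | one => simp
    | mul a b _ _ iha ihb => exact fun x => by rw [iha, ihb, mul_assoc]
    | inv a _ ih => exact fun x => by rw [ih (x * a⁻¹), inv_mul_cancel_right]
  exact (hR _).1 ((hL _).1 hw)

theorem bruhatLE.of_mem_doubleCoset_right {z y x : W} (hzy : cs.bruhatLE z y)
    (hI : ∀ i ∈ I, cs.bruhatLE z (cs.simple i * z))
    (hJ : ∀ i ∈ J, cs.bruhatLE z (z * cs.simple i)) (hx : x ∈ cs.doubleCoset I y J) :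
    cs.bruhatLE z x :=
  doubleCoset_induction (p := cs.bruhatLE z)
    (fun i hi _ h => (h.le_simple_mul i).elim id (hI i hi).trans)
    (fun i hi _ h => (h.le_mul_simple i).elim id (hJ i hi).trans) hzy hx

theorem bruhatLE.of_mem_doubleCoset_left {z y x : W} (hyz : cs.bruhatLE y z)
    (hI : ∀ i ∈ I, cs.bruhatLE (cs.simple i * z) z)
    (hJ : ∀ i ∈ J, cs.bruhatLE (z * cs.simple i) z) (hx : x ∈ cs.doubleCoset I y J) :
    cs.bruhatLE x z :=
  doubleCoset_induction (p := fun a => cs.bruhatLE a z)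
    (fun i hi _ h => (h.simple_mul_le i).elim id (fun h' => h'.trans (hI i hi)))
    (fun i hi _ h => (h.mul_simple_le i).elim id (fun h' => h'.trans (hJ i hi))) hyz hx

/-- If `x ≤ z` with `z` in the double coset of `u`, then some element of the double coset of `x`
is below `u`. -/
theorem exists_mem_doubleCoset_bruhatLE {u z x : W} (hz : z ∈ cs.doubleCoset I u J)
    (hxz : cs.bruhatLE x z) : ∃ y ∈ cs.doubleCoset I x J, cs.bruhatLE y u := by
  induction hn : cs.length z using Nat.strong_induction_on generalizing z x with
  | _ n ih =>
    by_cases hL : ∃ i ∈ I, cs.length (cs.simple i * z) < cs.length z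
    · obtain ⟨i, hi, hl⟩ := hL
      have hz' := simple_mul_mem_doubleCoset hz hi
      rcases hxz.le_simple_mul i with h | h
      · exact ih _ (hn ▸ hl) hz' h rfl
      · obtain ⟨y, hy, hyu⟩ := ih _ (hn ▸ hl) hz' h rfl
        exact ⟨y, mem_doubleCoset_trans hy
          (simple_mul_mem_doubleCoset (self_mem_doubleCoset x) hi), hyu⟩
    by_cases hR : ∃ i ∈ J, cs.length (z * cs.simple i) < cs.length z
    · obtain ⟨i, hi, hl⟩ := hR
      have hz' := mul_simple_mem_doubleCoset hz hi
      rcases hxz.le_mul_simple i with h | h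
      · exact ih _ (hn ▸ hl) hz' h rfl
      · obtain ⟨y, hy, hyu⟩ := ih _ (hn ▸ hl) hz' h rfl
        exact ⟨y, mem_doubleCoset_trans hy
          (mul_simple_mem_doubleCoset (self_mem_doubleCoset x) hi), hyu⟩
    push Not at hL hR
    have hzu : cs.bruhatLE z u := (bruhatLE.refl z).of_mem_doubleCoset_right
      (fun i hi => bruhatLE_simple_mul
        (lt_of_le_of_ne (hL i hi) (cs.length_simple_mul_ne z i).symm))
      (fun i hi => bruhatLE_mul_simple
        (lt_of_le_of_ne (hR i hi) (cs.length_mul_simple_ne z i).symm))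
      (mem_doubleCoset_symm hz)
    exact ⟨x, self_mem_doubleCoset x, hxz.trans hzu⟩

end DoubleCoset

end CoxeterSystem

/-- Interval test: a finite Bruhat interval `[u, v]` is a parabolic double coset if and
only if `u` is the minimal-length element of `W_I v W_J`, where
`I = asc_L(u) ∩ des_L(v)` and `J = asc_R(u) ∩ des_R(v)`; and in that case
`[u, v] = W_I v W_J`. -/
theorem bruhat_interval_is_parabolic_double_coset_iff
    [Fintype B] {M : CoxeterMatrix B} (cs : CoxeterSystem M W)
    (u v : W) (huv : cs.bruhatLE u v)
    (hfin : {x : W | cs.bruhatLE u x ∧ cs.bruhatLE x v}.Finite)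
    (I J : Set B)
    (hI : I = {s : B | cs.length u < cs.length (cs.simple s * u) ∧
      cs.length (cs.simple s * v) < cs.length v})
    (hJ : J = {s : B | cs.length u < cs.length (u * cs.simple s) ∧
      cs.length (v * cs.simple s) < cs.length v}) :
    ((∃ (I' J' : Set B) (x : W),
        {y : W | cs.bruhatLE u y ∧ cs.bruhatLE y v} = cs.doubleCoset I' x J') ↔
      (u ∈ cs.doubleCoset I v J ∧
        ∀ y ∈ cs.doubleCoset I v J, y ≠ u → cs.length u < cs.length y)) ∧
    ((u ∈ cs.doubleCoset I v J ∧
        ∀ y ∈ cs.doubleCoset I v J, y ≠ u → cs.length u < cs.length y) →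
      {y : W | cs.bruhatLE u y ∧ cs.bruhatLE y v} = cs.doubleCoset I v J) := by
  have huI : ∀ i ∈ I, cs.bruhatLE u (cs.simple i * u) := fun i hi =>
    bruhatLE_simple_mul (by rw [hI] at hi; exact hi.1)
  have huJ : ∀ i ∈ J, cs.bruhatLE u (u * cs.simple i) := fun i hi =>
    bruhatLE_mul_simple (by rw [hJ] at hi; exact hi.1)
  have hvI : ∀ i ∈ I, cs.bruhatLE (cs.simple i * v) v := fun i hi =>
    simple_mul_bruhatLE (by rw [hI] at hi; exact hi.2)
  have hvJ : ∀ i ∈ J, cs.bruhatLE (v * cs.simple i) v := fun i hi =>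
    mul_simple_bruhatLE (by rw [hJ] at hi; exact hi.2)
  have key : u ∈ cs.doubleCoset I v J →
      {y : W | cs.bruhatLE u y ∧ cs.bruhatLE y v} = cs.doubleCoset I v J := by
    intro hu
    ext x
    constructor
    · rintro ⟨hux, hxv⟩
      obtain ⟨y, hy, hyu⟩ := exists_mem_doubleCoset_bruhatLE (mem_doubleCoset_symm hu) hxv
      have huy := hux.of_mem_doubleCoset_right huI huJ hy
      rw [hyu.antisymm huy] at hy
      exact mem_doubleCoset_trans (mem_doubleCoset_symm hy) hu
    · intro hx
      exact ⟨huv.of_mem_doubleCoset_right huI huJ hx,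
        (bruhatLE.refl v).of_mem_doubleCoset_left hvI hvJ hx⟩
  refine ⟨⟨?_, fun h => ⟨I, J, v, key h.1⟩⟩, fun h => key h.1⟩
  rintro ⟨I', J', x, h⟩
  have hu : u ∈ cs.doubleCoset I' x J' := h ▸ ⟨bruhatLE.refl u, huv⟩
  have hv : v ∈ cs.doubleCoset I' x J' := h ▸ ⟨huv, bruhatLE.refl v⟩
  have hlt : ∀ {a b : W}, cs.bruhatLE a b → cs.length b ≠ cs.length a →
      cs.length a < cs.length b := fun hab hne =>
    hab.eq_or_length_lt.resolve_left fun e => hne (e ▸ rfl)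
  have hI' : I' ⊆ I := by
    intro i hi
    have h₁ := simple_mul_mem_doubleCoset hu hi
    have h₂ := simple_mul_mem_doubleCoset hv hi
    rw [← h] at h₁ h₂
    rw [hI]
    exact ⟨hlt h₁.1 (cs.length_simple_mul_ne u i), hlt h₂.2 (cs.length_simple_mul_ne v i).symm⟩
  have hJ' : J' ⊆ J := by
    intro i hi
    have h₁ := mul_simple_mem_doubleCoset hu hi
    have h₂ := mul_simple_mem_doubleCoset hv hi
    rw [← h] at h₁ h₂
    rw [hJ]
    exact ⟨hlt h₁.1 (cs.length_mul_simple_ne u i), hlt h₂.2 (cs.length_mul_simple_ne v i).symm⟩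
  refine ⟨doubleCoset_mono hI' hJ' v (mem_doubleCoset_trans hu (mem_doubleCoset_symm hv)), ?_⟩
  intro y hy hne
  exact (huv.of_mem_doubleCoset_right huI huJ hy).eq_or_length_lt.resolve_left hne.symm
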